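/- Let p, q be integers with p ≡ 1 (mod 2) and q ≡ 0 (mod 2), and let n ≥ 1. Then the generalized Fibonacci–Lucas quaternion G^{p,q}_n is a zero divisor in H[Z_2] (equivalently, not a unit) if and only if n ≡ 1 (mod 3). -/

import Mathlib

open Quaternion

/-- The Lucas sequence, as integers: `l_n = 2·f_{n+1} - f_n`
(equivalently `l_0 = 2`, `l_1 = 1`, `l_{n+2} = l_{n+1} + l_n`). -/
def lucas (n : ℕ) : ℤ := 2 * (Nat.fib (n + 1) : ℤ) - (Nat.fib n : ℤ)

/-- The generalized Fibonacci–Lucas numbers `g^{p,q}_n = p·f_{n-1} + q·l_n` (for `n ≥ 1`). -/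
def genFL (p q : ℤ) (n : ℕ) : ℤ := p * (Nat.fib (n - 1) : ℤ) + q * lucas n

/-- The n-th generalized Fibonacci–Lucas quaternion over a commutative ring `R`:
`G^{p,q}_n = g^{p,q}_n + g^{p,q}_{n+1}·i + g^{p,q}_{n+2}·j + g^{p,q}_{n+3}·k` in `ℍ[R]`. -/
def genFLQuat (R : Type*) [CommRing R] (p q : ℤ) (n : ℕ) : ℍ[R] :=
  ⟨(genFL p q n : R), (genFL p q (n + 1) : R), (genFL p q (n + 2) : R), (genFL p q (n + 3) : R)⟩

theorem Quaternion.isUnit_iff_isUnit_normSq {R : Type*} [CommRing R] (a : ℍ[R]) :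
    IsUnit a ↔ IsUnit (normSq a) := by
  refine ⟨fun h => h.map normSq, fun h => ?_⟩
  have hu : IsUnit ((normSq a : R) : ℍ[R]) := h.map (algebraMap R ℍ[R])
  have hl : IsUnit (a * star a) := by rwa [Quaternion.self_mul_star]
  have hr : IsUnit (star a * a) := by rwa [Quaternion.star_mul_self]
  rw [isUnit_iff_exists_and_exists]
  obtain ⟨b, hb⟩ := hl.exists_right_inv
  obtain ⟨c, hc⟩ := hr.exists_left_inv
  exact ⟨⟨star a * b, by rw [← mul_assoc, hb]⟩, ⟨c * star a, by rw [mul_assoc, hc]⟩⟩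

theorem genFL_succ_cast_zmod_two {p q : ℤ} (hp : p % 2 = 1) (hq : q % 2 = 0) (m : ℕ) :
    (genFL p q (m + 1) : ZMod 2) = (Nat.fib m : ZMod 2) := by
  have hp' : (p : ZMod 2) = 1 := by
    exact_mod_cast (ZMod.intCast_eq_intCast_iff p 1 2).2 hp
  have hq' : (q : ZMod 2) = 0 := (ZMod.intCast_zmod_eq_zero_iff_dvd q 2).2 (by omega)
  simp [genFL, hp', hq']

theorem Nat.two_dvd_fib_iff (n : ℕ) : 2 ∣ Nat.fib n ↔ 3 ∣ n := by
  have h : Nat.gcd 2 (Nat.fib n) = Nat.fib (Nat.gcd 3 n) := (Nat.fib_gcd 3 n).symm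
  rw [← Nat.gcd_eq_left_iff_dvd, h, ← Nat.gcd_eq_left_iff_dvd]
  rcases (Nat.dvd_prime Nat.prime_three).1 (Nat.gcd_dvd_left 3 n) with h | h <;>
    simp [h, Nat.fib_add_two]

theorem normSq_genFLQuat_zmod_two {p q : ℤ} (hp : p % 2 = 1) (hq : q % 2 = 0) (m : ℕ) :
    normSq (genFLQuat (ZMod 2) p q (m + 1)) = (Nat.fib (m + 3) : ZMod 2) := by
  have h3 : (Nat.fib (m + 3) : ZMod 2) = Nat.fib (m + 1) + Nat.fib (m + 2) := by
    exact_mod_cast congrArg (Nat.cast (R := ZMod 2)) (Nat.fib_add_two (n := m + 1))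
  have h2 : (Nat.fib (m + 2) : ZMod 2) = Nat.fib m + Nat.fib (m + 1) := by
    exact_mod_cast congrArg (Nat.cast (R := ZMod 2)) (Nat.fib_add_two (n := m))
  rw [Quaternion.normSq_def']
  simp only [genFLQuat, add_right_comm m 1, genFL_succ_cast_zmod_two hp hq, h3, h2]
  generalize (Nat.fib m : ZMod 2) = x
  generalize (Nat.fib (m + 1) : ZMod 2) = y
  revert x y
  decide

theorem genFLQuat_zmod_two_odd_even (p q : ℤ) (hp : p % 2 = 1) (hq : q % 2 = 0)
    (n : ℕ) (hn : 1 ≤ n) :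
    ¬ IsUnit (genFLQuat (ZMod 2) p q n) ↔ n % 3 = 1 := by
  obtain ⟨m, rfl⟩ := Nat.exists_eq_add_of_le' hn
  rw [Quaternion.isUnit_iff_isUnit_normSq, normSq_genFLQuat_zmod_two hp hq,
    isUnit_iff_ne_zero, not_not, ZMod.natCast_eq_zero_iff, Nat.two_dvd_fib_iff]
  omega
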